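/- Let d ∈ ℝ, p₀ᵢ > 0, p₀ⱼ > 0 and pᵢⱼ ∈ ℝ with pᵢⱼ² < p₀ᵢ p₀ⱼ. Let κ e^{λ(d)} be the bivariate Gaussian density with mean (−d,−d) and covariance [[p₀ᵢ, pᵢⱼ],[pᵢⱼ, p₀ⱼ]], i.e. κ = (2π √(p₀ᵢ p₀ⱼ − pᵢⱼ²))^{-1} and λ(d)(wᵢ, wⱼ) = −[(wᵢ+d)² p₀ⱼ + (wⱼ+d)² p₀ᵢ − 2 pᵢⱼ (wᵢ+d)(wⱼ+d)] / (2(p₀ᵢ p₀ⱼ − pᵢⱼ²)). Let g : ℝ → ℝ be a bounded measurable function, and define ε₁ = (2π p₀ⱼ³)^{-1/2} ∫_{-∞}^{∞} w g(w) e^{−(w+d)²/(2p₀ⱼ)} dw and ε₂ = (2π p₀ⱼ³)^{-1/2} ∫_{-∞}^{∞} g(w) e^{−(w+d)²/(2p₀ⱼ)} dw. Then ∫_{ℝ²} wᵢ g(wⱼ) κ e^{λ(d)(wᵢ,wⱼ)} dwᵢ dwⱼ = ε₁ pᵢⱼ − ε₂ d (p₀ⱼ − pᵢⱼ). -/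

import Mathlib

open Real MeasureTheory

/-- The exponent `λ(c)(wᵢ, wⱼ)` of the bivariate Gaussian density with mean `(-c,-c)`
and covariance `[[p₀ᵢ, pᵢⱼ], [pᵢⱼ, p₀ⱼ]]`. -/
noncomputable def lam (p0i p0j pij c wi wj : ℝ) : ℝ :=
  -((wi + c) ^ 2 * p0j + (wj + c) ^ 2 * p0i - 2 * pij * (wi + c) * (wj + c)) /
    (2 * (p0i * p0j - pij ^ 2))

open ProbabilityTheory

theorem integrable_exp_neg_mul_add_sq {b : ℝ} (hb : 0 < b) (d : ℝ) :
    Integrable fun w : ℝ => exp (-b * (w + d) ^ 2) :=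
  (integrable_exp_neg_mul_sq hb).comp_add_right d

theorem integrable_mul_exp_neg_mul_add_sq {b : ℝ} (hb : 0 < b) (d : ℝ) :
    Integrable fun w : ℝ => w * exp (-b * (w + d) ^ 2) := by
  have h := ((integrable_mul_exp_neg_mul_sq hb).comp_add_right d).sub
    ((integrable_exp_neg_mul_add_sq hb d).const_mul d)
  refine h.congr (.of_forall fun w => ?_)
  simp only [Pi.sub_apply]
  ring

/-- The first moment of an unnormalized Gaussian weight. -/
theorem integral_mul_exp_neg_sub_sq_div {s : ℝ} (hs : 0 < s) (m : ℝ) :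
    ∫ x : ℝ, x * exp (-(x - m) ^ 2 / (2 * s)) = √(2 * π * s) * m := by
  have hs' : s.toNNReal ≠ 0 := by simpa using hs
  have h := integral_id_gaussianReal (μ := m) (v := s.toNNReal)
  rw [integral_gaussianReal_eq_integral_smul hs'] at h
  simp only [gaussianPDFReal, Real.coe_toNNReal s hs.le, smul_eq_mul, mul_assoc] at h
  rw [integral_const_mul] at h
  have hpos : √(2 * (π * s)) ≠ 0 := by positivity
  simp_rw [mul_comm (exp _)] at h
  rw [mul_assoc, (inv_mul_eq_iff_eq_mul₀ hpos).1 h]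

/-- Completing the square: the bivariate exponent splits into the marginal exponent of the second
coordinate and the conditional exponent of the first. -/
theorem lam_eq_add {p0i p0j pij : ℝ} (hj : 0 < p0j) (hij : pij ^ 2 < p0i * p0j) (d x y : ℝ) :
    lam p0i p0j pij d x y = -(y + d) ^ 2 / (2 * p0j) +
      -(x - (-d + pij / p0j * (y + d))) ^ 2 / (2 * ((p0i * p0j - pij ^ 2) / p0j)) := by
  have hD : p0i * p0j - pij ^ 2 ≠ 0 := (sub_pos.2 hij).ne'
  have hp : p0i = (p0i * p0j - pij ^ 2 + pij ^ 2) / p0j := by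
    field_simp
    ring
  unfold lam
  generalize p0i * p0j - pij ^ 2 = D at hD hp ⊢
  rw [hp]
  field_simp
  ring

/-- The smallest eigenvalue of the inverse covariance is at least the inverse of the trace of the
covariance. -/
theorem lam_le {p0i p0j pij : ℝ} (hi : 0 < p0i) (hj : 0 < p0j) (hij : pij ^ 2 < p0i * p0j)
    (d x y : ℝ) :
    lam p0i p0j pij d x y ≤
      -(2 * (p0i + p0j))⁻¹ * (x + d) ^ 2 + -(2 * (p0i + p0j))⁻¹ * (y + d) ^ 2 := by
  have hD : 0 < p0i * p0j - pij ^ 2 := sub_pos.2 hij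
  have hT : 0 < p0i + p0j := add_pos hi hj
  have h : -(2 * (p0i + p0j))⁻¹ * (x + d) ^ 2 + -(2 * (p0i + p0j))⁻¹ * (y + d) ^ 2 =
      -((x + d) ^ 2 + (y + d) ^ 2) / (2 * (p0i + p0j)) := by
    field_simp
    ring
  rw [h, lam, div_le_div_iff₀ (by positivity) (by positivity)]
  nlinarith [sq_nonneg (p0j * (x + d) - pij * (y + d)), sq_nonneg (p0i * (y + d) - pij * (x + d))]

theorem integrable_mul_mul_exp_lam {p0i p0j pij : ℝ} (hi : 0 < p0i) (hj : 0 < p0j)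
    (hij : pij ^ 2 < p0i * p0j) (d K : ℝ) {g : ℝ → ℝ} (hg : Measurable g)
    {C : ℝ} (hC : ∀ w, |g w| ≤ C) :
    Integrable (fun z : ℝ × ℝ => z.1 * g z.2 * (K * exp (lam p0i p0j pij d z.1 z.2)))
      (volume.prod volume) := by
  have hb : 0 < (2 * (p0i + p0j))⁻¹ := by positivity
  have hdom := ((integrable_mul_exp_neg_mul_add_sq hb d).mul_prod
    (integrable_exp_neg_mul_add_sq hb d)).const_mul (C * |K|)
  refine hdom.mono ?_ (.of_forall fun z => ?_)
  · unfold lam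
    exact Measurable.aestronglyMeasurable (by fun_prop)
  · have hC0 : 0 ≤ C := (abs_nonneg _).trans (hC 0)
    simp only [norm_mul, Real.norm_eq_abs, abs_exp, abs_abs, abs_of_nonneg hC0]
    calc |z.1| * |g z.2| * (|K| * exp (lam p0i p0j pij d z.1 z.2))
        ≤ |z.1| * C * (|K| * exp (-(2 * (p0i + p0j))⁻¹ * (z.1 + d) ^ 2 +
            -(2 * (p0i + p0j))⁻¹ * (z.2 + d) ^ 2)) := by
          gcongr
          · exact hC _
          · exact lam_le hi hj hij d z.1 z.2
      _ = _ := by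
          rw [exp_add]
          ring

/-- Integrating out the first coordinate gives the conditional mean times the marginal density. -/
theorem integral_mul_exp_lam {p0i p0j pij : ℝ} (hj : 0 < p0j) (hij : pij ^ 2 < p0i * p0j)
    (d y : ℝ) :
    ∫ x : ℝ, x * ((2 * π * √(p0i * p0j - pij ^ 2))⁻¹ * exp (lam p0i p0j pij d x y)) =
      (√(2 * π * p0j ^ 3))⁻¹ * (pij * y - d * (p0j - pij)) * exp (-(y + d) ^ 2 / (2 * p0j)) := by
  have hD : 0 < p0i * p0j - pij ^ 2 := sub_pos.2 hij
  have hsplit : ∀ x : ℝ,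
      x * ((2 * π * √(p0i * p0j - pij ^ 2))⁻¹ * exp (lam p0i p0j pij d x y)) =
      ((2 * π * √(p0i * p0j - pij ^ 2))⁻¹ * exp (-(y + d) ^ 2 / (2 * p0j))) *
        (x * exp (-(x - (-d + pij / p0j * (y + d))) ^ 2 /
          (2 * ((p0i * p0j - pij ^ 2) / p0j)))) := fun x => by
    rw [lam_eq_add hj hij, exp_add]
    ring
  simp_rw [hsplit]
  rw [integral_const_mul, integral_mul_exp_neg_sub_sq_div (div_pos hD hj)]
  have hroot : √(2 * π * ((p0i * p0j - pij ^ 2) / p0j)) * √(2 * π * p0j ^ 3) =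
      2 * π * √(p0i * p0j - pij ^ 2) * p0j := by
    rw [← sqrt_mul (by positivity), show 2 * π * ((p0i * p0j - pij ^ 2) / p0j) *
      (2 * π * p0j ^ 3) = (2 * π * p0j) ^ 2 * (p0i * p0j - pij ^ 2) by field_simp,
      sqrt_mul (by positivity), sqrt_sq (by positivity)]
    ring
  have h3 : √(2 * π * p0j ^ 3) ≠ 0 := by positivity
  have hroot' := eq_div_of_mul_eq h3 hroot
  have hsD : √(p0i * p0j - pij ^ 2) ≠ 0 := by positivity
  rw [hroot']
  field_simp
  ring

/-- The general modified Bussgang law for non-stationary inputs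
(equations (88)–(90)): for any bounded measurable `g`,
`E[Wᵢ g(Wⱼ)] = ε₁ pᵢⱼ - ε₂ d (p₀ⱼ - pᵢⱼ)`. -/
theorem modified_bussgang_general (d p0i p0j pij : ℝ) (hi : 0 < p0i) (hj : 0 < p0j)
    (hij : pij ^ 2 < p0i * p0j) (g : ℝ → ℝ) (hg : Measurable g)
    (hb : ∃ C, ∀ w, |g w| ≤ C) :
    (∫ wi : ℝ, ∫ wj : ℝ, wi * g wj *
        ((2 * Real.pi * Real.sqrt (p0i * p0j - pij ^ 2))⁻¹ *
          Real.exp (lam p0i p0j pij d wi wj)))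
      = ((Real.sqrt (2 * Real.pi * p0j ^ 3))⁻¹ *
            ∫ w : ℝ, w * g w * Real.exp (-(w + d) ^ 2 / (2 * p0j))) * pij
        - ((Real.sqrt (2 * Real.pi * p0j ^ 3))⁻¹ *
            ∫ w : ℝ, g w * Real.exp (-(w + d) ^ 2 / (2 * p0j))) * d * (p0j - pij) := by
  obtain ⟨C, hC⟩ := hb
  have hb : 0 < (2 * p0j)⁻¹ := by positivity
  have hexp : ∀ w : ℝ, -(2 * p0j)⁻¹ * (w + d) ^ 2 = -(w + d) ^ 2 / (2 * p0j) := fun w => by ring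
  have hint₀ : Integrable fun w : ℝ => g w * exp (-(w + d) ^ 2 / (2 * p0j)) := by
    have h := integrable_exp_neg_mul_add_sq hb d
    simp_rw [hexp] at h
    exact h.bdd_mul hg.aestronglyMeasurable (.of_forall hC)
  have hint₁ : Integrable fun w : ℝ => w * g w * exp (-(w + d) ^ 2 / (2 * p0j)) := by
    have h := integrable_mul_exp_neg_mul_add_sq hb d
    simp_rw [hexp] at h
    refine (h.bdd_mul hg.aestronglyMeasurable (.of_forall hC)).congr (.of_forall fun w => ?_)
    ring
  rw [integral_integral_swap (integrable_mul_mul_exp_lam hi hj hij d _ hg hC)]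
  have hinner : ∀ y : ℝ, ∫ x : ℝ, x * g y *
      ((2 * π * √(p0i * p0j - pij ^ 2))⁻¹ * exp (lam p0i p0j pij d x y)) =
      ((√(2 * π * p0j ^ 3))⁻¹ * pij) * (y * g y * exp (-(y + d) ^ 2 / (2 * p0j))) -
      ((√(2 * π * p0j ^ 3))⁻¹ * d * (p0j - pij)) *
        (g y * exp (-(y + d) ^ 2 / (2 * p0j))) := fun y => by
    simp_rw [mul_comm _ (g y), mul_assoc (g y)]
    rw [integral_const_mul, integral_mul_exp_lam hj hij]
    ring
  simp_rw [hinner]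
  rw [integral_sub (hint₁.const_mul _) (hint₀.const_mul _), integral_const_mul, integral_const_mul]
  ring
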